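/- There exist a bounded, simply connected open set U ⊆ ℝ² and ε > 0 such that for every contraction f : U → ℝ² with λ(f(U)) ≥ λ(U) - ε, the boundary of f(U) has positive Lebesgue measure; in particular f(U) is not a polygon. -/

import Mathlib

open MeasureTheory Metric Set ENNReal

open Filter Topology

local notation "Plane" => EuclideanSpace ℝ (Fin 2)

theorem volume_image_le_of_lipschitzOnWith_one {f : Plane → Plane} {s : Set Plane}
    (hf : LipschitzOnWith 1 f s) : volume (f '' s) ≤ volume s := by
  rw [← EuclideanSpace.euclideanHausdorffMeasure_eq_volume 2,
    Measure.euclideanHausdorffMeasure_def, Measure.smul_apply, Measure.smul_apply]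
  have h := hf.hausdorffMeasure_image_le (d := ((2 : ℕ) : ℝ)) (by positivity)
  rw [ENNReal.coe_one, ENNReal.one_rpow, one_mul] at h
  gcongr

theorem volume_segment_eq_zero (p q : Plane) : volume (segment ℝ p q) = 0 := by
  refine measure_mono_null (t := (line[ℝ, p, q] : Set Plane)) ?_ ?_
  · rw [← convexHull_pair]
    exact convexHull_subset_affineSpan _
  · refine Measure.addHaar_affineSubspace _ _ fun h ↦ ?_
    have h2 := collinear_pair ℝ p q
    rw [collinear_iff_finrank_le_one, ← direction_affineSpan, h, AffineSubspace.direction_top,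
      finrank_top, finrank_euclideanSpace_fin] at h2
    norm_num at h2

/-- A continuous self-map of a disc that moves no point by more than `η` covers the concentric
disc whose radius is smaller by `η`. -/
theorem Complex.mem_image_ball_of_dist_le {g : ℂ → ℂ} {R η : ℝ} {p : ℂ} (hη : 0 ≤ η)
    (hg : ContinuousOn g (ball 0 R)) (hgη : ∀ z ∈ ball (0 : ℂ) R, dist (g z) z ≤ η)
    (hp : ‖p‖ + η < R) : p ∈ g '' ball 0 R := by
  by_contra hpg
  obtain ⟨r, hr, hrR⟩ := exists_between hp
  have hr0 : 0 < r := by linarith [norm_nonneg p]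
  have hsc : IsSimplyConnected (ball (0 : ℂ) R) := by
    have := (convex_ball (0 : ℂ) R).contractibleSpace ⟨0, mem_ball_self (hr0.trans hrR)⟩
    exact SimplyConnectedSpace.ofContractible _
  obtain ⟨h, hh, hexp⟩ := exists_continuousOn_eqOn_exp_comp hsc isOpen_ball
    (g := fun z ↦ g z - p) (hg.sub continuousOn_const) (by
      rintro ⟨z, hz, hzp⟩
      exact hpg ⟨z, hz, sub_eq_zero.1 hzp⟩)
  have hγb : ∀ t : ℝ, circleMap 0 r t ∈ ball (0 : ℂ) R := fun t ↦ by simpa [abs_of_pos hr0]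
  have hγ0 : ∀ t : ℝ, circleMap 0 r t ≠ 0 := fun t ↦ circleMap_ne_center hr0.ne'
  set q : ℝ → ℂ := fun t ↦ (g (circleMap 0 r t) - p) / circleMap 0 r t with hq
  have hgc : Continuous fun t : ℝ ↦ g (circleMap 0 r t) :=
    hg.comp_continuous (continuous_circleMap 0 r) hγb
  have hhc : Continuous fun t : ℝ ↦ h (circleMap 0 r t) :=
    hh.comp_continuous (continuous_circleMap 0 r) hγb
  have hqc : Continuous q := (hgc.sub continuous_const).div (continuous_circleMap 0 r) hγ0
  have hq1 : ∀ t, q t ∈ slitPlane := fun t ↦ by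
    have h1 : q t = 1 + (g (circleMap 0 r t) - circleMap 0 r t - p) / circleMap 0 r t := by
      have := hγ0 t
      simp only [hq]
      field_simp
      ring
    rw [h1]
    refine mem_slitPlane_of_norm_lt_one ?_
    rw [norm_div, norm_circleMap_zero, abs_of_pos hr0, div_lt_one hr0]
    have h2 := hgη _ (hγb t)
    rw [dist_eq_norm] at h2
    linarith [norm_sub_le (g (circleMap 0 r t) - circleMap 0 r t) p]
  set φ : ℝ → ℂ := fun t ↦ h (circleMap 0 r t) - log (q t) - t * I with hφ
  have hφc : Continuous φ := by
    have := hqc.clog hq1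
    exact (hhc.sub this).sub (continuous_ofReal.mul continuous_const)
  have hφexp : ∀ t, exp (φ t) = r := fun t ↦ by
    have h1 : exp (h (circleMap 0 r t)) = g (circleMap 0 r t) - p := hexp (hγb t)
    have h2 := slitPlane_ne_zero (hq1 t)
    have h3 : g (circleMap 0 r t) - p = q t * (r * exp (t * I)) := by
      have := hγ0 t
      rw [← circleMap_zero]
      simp only [hq]
      field_simp
    rw [hφ, exp_sub, exp_sub, exp_log h2, h1, h3]
    have := exp_ne_zero (t * I)
    field_simp
  have hper : circleMap 0 r (2 * Real.pi) = circleMap 0 r 0 := by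
    simp [circleMap]
  have hend : (φ (2 * Real.pi)).im = (φ 0).im - 2 * Real.pi := by
    simp [hφ, hq, hper]
  obtain ⟨t, -, ht⟩ := intermediate_value_Icc' (by positivity : (0 : ℝ) ≤ 2 * Real.pi)
    (continuous_im.comp hφc).continuousOn
    (show (φ 0).im - Real.pi ∈ _ by
      simp only [Function.comp, hend]
      constructor <;> linarith [Real.pi_pos])
  have h1 : exp (φ t - φ 0) = 1 := by
    rw [exp_sub, hφexp, hφexp, div_self (by exact_mod_cast hr0.ne')]
  have h2 : (exp (φ t - φ 0)).re < 0 := by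
    have h3 : (φ t - φ 0).im = - Real.pi := by
      rw [sub_im, show (φ t).im = _ from ht]
      ring
    rw [exp_re, h3, Real.cos_neg, Real.cos_pi]
    linarith [Real.exp_pos (φ t - φ 0).re]
  rw [h1] at h2
  norm_num at h2

theorem mem_image_ball_of_dist_le {g : Plane → Plane} {R η : ℝ} {p : Plane} (hη : 0 ≤ η)
    (hg : ContinuousOn g (ball 0 R)) (hgη : ∀ z ∈ ball (0 : Plane) R, dist (g z) z ≤ η)
    (hp : ‖p‖ + η < R) : p ∈ g '' ball 0 R := by
  let e : ℂ ≃ₗᵢ[ℝ] Plane := Complex.orthonormalBasisOneI.repr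
  have he : ∀ z ∈ ball (0 : ℂ) R, e z ∈ ball (0 : Plane) R := fun z hz ↦ by
    simpa using hz
  obtain ⟨z, hz, hzp⟩ := Complex.mem_image_ball_of_dist_le (g := fun z ↦ e.symm (g (e z)))
    (p := e.symm p) hη
    (e.symm.continuous.comp_continuousOn (hg.comp e.continuous.continuousOn he))
    (fun z hz ↦ by
      have h := hgη _ (he z hz)
      rw [← e.symm.dist_map] at h
      simpa using h)
    (by simpa using hp)
  exact ⟨e z, he z hz, e.symm.injective hzp⟩

section LocalIsometry

variable {V W : Type*} [NormedAddCommGroup V] [InnerProductSpace ℝ V] [FiniteDimensional ℝ V]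
  [NormedAddCommGroup W] [InnerProductSpace ℝ W]

/-- A distance-preserving map on a ball of a finite-dimensional inner product space is affine. -/
theorem exists_linearIsometry_of_dist_eq_on_ball {F : V → W} {z : V} {ρ : ℝ} (hρ : 0 < ρ)
    (hF : ∀ x ∈ ball z ρ, ∀ y ∈ ball z ρ, dist (F x) (F y) = dist x y) :
    ∃ L : V →ₗᵢ[ℝ] W, ∀ x ∈ ball z ρ, F x = F z + L (x - z) := by
  have hz : z ∈ ball z ρ := mem_ball_self hρ
  have hnorm : ∀ x ∈ ball z ρ, ‖F x - F z‖ = ‖x - z‖ := fun x hx ↦ by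
    simpa [dist_eq_norm] using hF x hx z hz
  have hinner : ∀ x ∈ ball z ρ, ∀ y ∈ ball z ρ,
      inner ℝ (F x - F z) (F y - F z) = inner ℝ (x - z) (y - z) := fun x hx y hy ↦ by
    have h := hF x hx y hy
    rw [dist_eq_norm, dist_eq_norm] at h
    rw [real_inner_eq_norm_mul_self_add_norm_mul_self_sub_norm_sub_mul_self_div_two,
      real_inner_eq_norm_mul_self_add_norm_mul_self_sub_norm_sub_mul_self_div_two,
      hnorm x hx, hnorm y hy, sub_sub_sub_cancel_right, sub_sub_sub_cancel_right, h]
  let b := stdOrthonormalBasis ℝ V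
  let r := ρ / 2
  have hr : 0 < r := half_pos hρ
  have hb : ∀ i, z + r • b i ∈ ball z ρ := fun i ↦ by
    simp [norm_smul, r, hρ, abs_of_pos hρ]
  let w := fun i ↦ r⁻¹ • (F (z + r • b i) - F z)
  have hxw : ∀ x ∈ ball z ρ, ∀ i, inner ℝ (F x - F z) (w i) = inner ℝ (x - z) (b i) :=
    fun x hx i ↦ by
      rw [inner_smul_right, hinner x hx _ (hb i), add_sub_cancel_left, inner_smul_right,
        inv_mul_cancel_left₀ hr.ne']
  have hw : Orthonormal ℝ w := by
    classical
    rw [orthonormal_iff_ite]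
    intro i j
    rw [← orthonormal_iff_ite.1 b.orthonormal i j]
    change inner ℝ (r⁻¹ • (F (z + r • b i) - F z)) (w j) = _
    rw [real_inner_smul_left, hxw _ (hb i), add_sub_cancel_left, real_inner_smul_left,
      inv_mul_cancel_left₀ hr.ne']
  let T : V →ₗ[ℝ] W := b.toBasis.constr ℝ w
  have hT : ∀ i, T (b i) = w i := fun i ↦ by
    rw [← b.coe_toBasis]
    exact b.toBasis.constr_basis ℝ w i
  let L : V →ₗᵢ[ℝ] W := T.isometryOfOrthonormal (v := b.toBasis) (by simp)
    (by convert hw using 1; ext i; simp [hT])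
  have hL : ∀ x ∈ ball z ρ, ∀ v, inner ℝ (F x - F z) (L v) = inner ℝ (x - z) v := fun x hx v ↦ by
    conv_rhs => rw [← b.sum_repr v]
    conv_lhs => rw [← b.sum_repr v]
    simp only [map_sum, map_smul, inner_sum, inner_smul_right]
    refine Finset.sum_congr rfl fun i _ ↦ ?_
    rw [← hxw x hx i, ← hT i]
    rfl
  refine ⟨L, fun x hx ↦ ?_⟩
  rw [← sub_eq_iff_eq_add', ← sub_eq_zero, ← inner_self_eq_zero (𝕜 := ℝ), inner_sub_sub_self,
    real_inner_comm (F x - F z) (L (x - z)), hL x hx, L.inner_map_map, hinner x hx x hx]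
  simp

/-- A locally distance-preserving map on a connected open set is the restriction of an affine
isometry. -/
theorem exists_linearIsometry_of_locally_dist_eq {F : V → W} {U : Set V} (hU : IsOpen U)
    (hUc : IsPreconnected U)
    (hF : ∀ z ∈ U, ∃ ρ > 0, ∀ x ∈ ball z ρ, ∀ y ∈ ball z ρ, dist (F x) (F y) = dist x y) :
    ∀ a ∈ U, ∃ L : V →ₗᵢ[ℝ] W, ∀ x ∈ U, F x = F a + L (x - a) := by
  have hloc : ∀ z ∈ U, ∃ L : V →ₗᵢ[ℝ] W, ∀ᶠ y in 𝓝 z,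
      HasFDerivAt F L.toContinuousLinearMap y := fun z hz ↦ by
    obtain ⟨ρ, hρ, h⟩ := hF z hz
    obtain ⟨L, hL⟩ := exists_linearIsometry_of_dist_eq_on_ball hρ h
    refine ⟨L, ?_⟩
    filter_upwards [isOpen_ball.mem_nhds (mem_ball_self hρ)] with y hy
    have h1 : HasFDerivAt (fun x ↦ F z + L.toContinuousLinearMap (x - z))
        L.toContinuousLinearMap y := by
      simpa using (L.toContinuousLinearMap.hasFDerivAt.comp y
        ((hasFDerivAt_id y).sub_const z)).const_add (F z)
    refine h1.congr_of_eventuallyEq ?_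
    filter_upwards [isOpen_ball.mem_nhds hy] with x hx using hL x hx
  intro a ha
  have hdiff : DifferentiableOn ℝ F U := fun z hz ↦ by
    obtain ⟨L, hL⟩ := hloc z hz
    exact hL.self_of_nhds.differentiableAt.differentiableWithinAt
  have hconst : ∀ z ∈ U, HasFDerivAt (fderiv ℝ F) (0 : V →L[ℝ] V →L[ℝ] W) z := fun z hz ↦ by
    obtain ⟨L, hL⟩ := hloc z hz
    refine (hasFDerivAt_const L.toContinuousLinearMap z).congr_of_eventuallyEq ?_
    filter_upwards [hL] with y hy using hy.fderiv
  obtain ⟨L, hL⟩ := hloc a ha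
  refine ⟨L, fun x hx ↦ ?_⟩
  have hG : ∀ y, HasFDerivAt (fun x ↦ F a + L (x - a)) L.toContinuousLinearMap y := fun y ↦ by
    simpa using (L.toContinuousLinearMap.hasFDerivAt.comp y
      ((hasFDerivAt_id y).sub_const a)).const_add (F a)
  refine hU.eqOn_of_fderiv_eq (𝕜 := ℝ) hUc hdiff
    (fun y _ ↦ (hG y).differentiableAt.differentiableWithinAt) (fun y hy ↦ ?_) ha (by simp) hx
  rw [(hG y).fderiv, ← hL.self_of_nhds.fderiv]
  exact hU.is_const_of_fderiv_eq_zero hUc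
    (fun z hz ↦ (hconst z hz).differentiableAt.differentiableWithinAt)
    (fun z hz ↦ (hconst z hz).fderiv) hy ha

end LocalIsometry

/-- A nonexpansive map for which the images of the centres of two disjoint discs are so close that
the discs around them overlap in a disc `ball m s` loses at least the area of that disc. -/
theorem volume_image_add_volume_ball_le {f : Plane → Plane} {U : Set Plane} {x y m : Plane}
    {r s : ℝ} (hf : LipschitzOnWith 1 f U) (hr : 0 < r)
    (hx : ball x r ⊆ U) (hy : ball y r ⊆ U) (hxy : Disjoint (ball x r) (ball y r))
    (hmx : ball m s ⊆ ball (f x) r) (hmy : ball m s ⊆ ball (f y) r) :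
    volume (f '' U) + volume (ball m s) ≤ volume U := by
  have hball : ∀ z, ball z r ⊆ U → f '' ball z r ⊆ ball (f z) r := fun z hz ↦ by
    rintro _ ⟨w, hw, rfl⟩
    have h := hf.dist_le_mul w (hz hw) z (hz (mem_ball_self hr))
    rw [NNReal.coe_one, one_mul] at h
    exact h.trans_lt hw
  have hUsub : ball x r ∪ ball y r ⊆ U := union_subset hx hy
  have hsub : f '' U ⊆ (ball (f x) r ∪ ball (f y) r) ∪ f '' (U \ (ball x r ∪ ball y r)) := by
    conv_lhs => rw [← union_sdiff_cancel hUsub]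
    rw [image_union, image_union]
    gcongr
    · exact hball x hx
    · exact hball y hy
  calc volume (f '' U) + volume (ball m s)
      ≤ (volume (ball (f x) r ∪ ball (f y) r) + volume (f '' (U \ (ball x r ∪ ball y r))))
        + volume (ball (f x) r ∩ ball (f y) r) := by
        gcongr
        · exact (measure_mono hsub).trans (measure_union_le _ _)
        · exact subset_inter hmx hmy
    _ = volume (ball (f x) r) + volume (ball (f y) r)
        + volume (f '' (U \ (ball x r ∪ ball y r))) := by
        rw [add_right_comm, measure_union_add_inter _ measurableSet_ball]
    _ ≤ volume (ball x r ∪ ball y r) + volume (U \ (ball x r ∪ ball y r)) := by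
        rw [measure_union hxy measurableSet_ball, Measure.addHaar_ball_center volume (f x),
          Measure.addHaar_ball_center volume (f y), Measure.addHaar_ball_center volume x,
          Measure.addHaar_ball_center volume y]
        exact add_le_add_right (volume_image_le_of_lipschitzOnWith_one (hf.mono sdiff_subset)) _
    _ = volume U := by
        rw [measure_add_sdiff (measurableSet_ball.union measurableSet_ball).nullMeasurableSet,
          union_eq_self_of_subset_left hUsub]

/-- A pointwise limit of nonexpansive maps that asymptotically preserve the area of `U` preserves
the distance between the centres of two tangent discs contained in `U`. -/
theorem dist_eq_of_tendsto_of_volume_le {ι : Type*} {l : Filter ι} [l.NeBot]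
    {f : ι → Plane → Plane} {F : Plane → Plane} {U : Set Plane} {ε : ι → ℝ≥0∞}
    (hU : volume U ≠ ∞) (hf : ∀ i, LipschitzOnWith 1 (f i) U) (hε : Tendsto ε l (𝓝 0))
    (hvol : ∀ i, volume U ≤ volume (f i '' U) + ε i)
    (hF : ∀ x ∈ U, Tendsto (fun i ↦ f i x) l (𝓝 (F x))) {x y : Plane} {r : ℝ}
    (hr : 0 < r) (hxy : dist x y = 2 * r) (hx : ball x r ⊆ U) (hy : ball y r ⊆ U) :
    dist (F x) (F y) = dist x y := by
  have hxU : x ∈ U := hx (mem_ball_self hr)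
  have hyU : y ∈ U := hy (mem_ball_self hr)
  refine le_antisymm (le_of_tendsto ((hF x hxU).dist (hF y hyU)) (.of_forall fun i ↦ ?_)) ?_
  · simpa using (hf i).dist_le_mul x hxU y hyU
  by_contra! hlt
  rw [hxy] at hlt
  set s : ℝ := (r - dist (F x) (F y) / 2) / 2 with hs
  have hs0 : 0 < s := by linarith
  set m := midpoint ℝ (F x) (F y)
  have hvs : 0 < volume (ball m s) := measure_ball_pos _ _ hs0
  obtain ⟨i, hix, hiy, hi⟩ := ((tendsto_nhds.1 (hF x hxU) s hs0).and
    ((tendsto_nhds.1 (hF y hyU) s hs0).and (hε.eventually_lt_const hvs))).exists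
  have hmx : dist m (F x) = dist (F x) (F y) / 2 := by
    rw [dist_midpoint_left]
    simp
    ring
  have hmy : dist m (F y) = dist (F x) (F y) / 2 := by
    rw [dist_midpoint_right]
    simp
    ring
  have hle := volume_image_add_volume_ball_le (hf i) (m := m) (s := s) hr hx hy
    (ball_disjoint_ball (by linarith))
    (ball_subset_ball' (by
      rw [dist_comm] at hix
      linarith [dist_triangle m (F x) (f i x)]))
    (ball_subset_ball' (by
      rw [dist_comm] at hiy
      linarith [dist_triangle m (F y) (f i y)]))
  have hfin : volume (f i '' U) ≠ ∞ :=
    ((volume_image_le_of_lipschitzOnWith_one (hf i)).trans_lt hU.lt_top).ne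
  exact ((hvol i).trans_lt (ENNReal.add_lt_add_left hfin hi)).not_ge hle

theorem exists_ultrafilter_tendsto {f : ℕ → Plane → Plane} {U : Set Plane} (h0 : 0 ∈ U)
    (hf : ∀ n, LipschitzOnWith 1 (f n) U) (hf0 : ∀ n, f n 0 = 0) (l : Ultrafilter ℕ) :
    ∃ F : Plane → Plane, ∀ x ∈ U, Tendsto (fun n ↦ f n x) l (𝓝 (F x)) := by
  have : ∀ x, ∃ y, x ∈ U → Tendsto (fun n ↦ f n x) l (𝓝 y) := fun x ↦ by
    by_cases hx : x ∈ U
    · obtain ⟨y, -, hy⟩ := (isCompact_closedBall (0 : Plane) ‖x‖).ultrafilter_le_nhds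
        (l.map fun n ↦ f n x) (by
          rw [le_principal_iff]
          refine Filter.mem_map.2 (univ_mem' fun n ↦ ?_)
          simpa [hf0 n] using (hf n).dist_le_mul x hx 0 h0)
      exact ⟨y, fun _ ↦ hy⟩
    · exact ⟨0, fun h ↦ absurd h hx⟩
  choose F hF using this
  exact ⟨F, hF⟩

/-- If `U` is small in area but dense in a disc, then among nonexpansive maps that asymptotically
preserve the area of `U` there is one for which the closure of the image has larger area. -/
theorem exists_volume_lt_volume_closure_image {U : Set Plane} (hUo : IsOpen U)
    (hUc : IsPreconnected U) (hUb : Bornology.IsBounded U) (h0 : 0 ∈ U)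
    (hUd : ball 0 1 ⊆ closure U) (hUv : volume U < volume (ball (0 : Plane) (1 / 2)))
    {f : ℕ → Plane → Plane} {ε : ℕ → ℝ≥0∞} (hf : ∀ n, LipschitzOnWith 1 (f n) U)
    (hf0 : ∀ n, f n 0 = 0) (hε : Tendsto ε atTop (𝓝 0))
    (hvol : ∀ n, volume U ≤ volume (f n '' U) + ε n) :
    ∃ n, volume U < volume (closure (f n '' U)) := by
  obtain ⟨F, hF⟩ := exists_ultrafilter_tendsto h0 hf hf0 (hyperfilter ℕ)
  have hF0 : F 0 = 0 := by
    refine tendsto_nhds_unique (hF 0 h0) ?_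
    simp [hf0]
  have hloc : ∀ z ∈ U, ∃ ρ > 0, ∀ x ∈ ball z ρ, ∀ y ∈ ball z ρ,
      dist (F x) (F y) = dist x y := fun z hz ↦ by
    obtain ⟨ρ, hρ, hzU⟩ := Metric.isOpen_iff.1 hUo z hz
    refine ⟨ρ / 2, half_pos hρ, fun x hx y hy ↦ ?_⟩
    rcases eq_or_ne x y with rfl | hne
    · simp
    rw [mem_ball] at hx hy
    have hxy : dist x y < ρ := by linarith [dist_triangle_right x y z]
    exact dist_eq_of_tendsto_of_volume_le hUb.measure_lt_top.ne hf
      (hε.mono_left Nat.hyperfilter_le_atTop) hvol hF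
      (r := dist x y / 2) (half_pos (dist_pos.2 hne)) (by ring)
      ((ball_subset_ball' (by linarith)).trans hzU) ((ball_subset_ball' (by linarith)).trans hzU)
  obtain ⟨L, hL⟩ := exists_linearIsometry_of_locally_dist_eq hUo hUc hloc 0 h0
  let e : Plane ≃ₗᵢ[ℝ] Plane := L.toLinearIsometryEquiv rfl
  have he : ∀ x ∈ U, F x = e x := fun x hx ↦ by
    have h := hL x hx
    rwa [hF0, zero_add, sub_zero] at h
  set C : NNReal := lipschitzExtensionConstant Plane * 1
  set s : ℝ := 1 / (8 * (C + 1)) with hs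
  have hs0 : 0 < s := by positivity
  obtain ⟨t, htU, htf, ht⟩ := finite_approx_of_totallyBounded
    (hUb.isCompact_closure.totallyBounded.subset subset_closure) s hs0
  have hev : ∀ᶠ n in (hyperfilter ℕ : Filter ℕ), ∀ x ∈ t, dist (f n x) (e x) < 1 / 8 :=
    (eventually_all_finite htf).2 fun x hx ↦ by
      rw [← he x (htU hx)]
      exact tendsto_nhds.1 (hF x (htU hx)) _ (by norm_num)
  obtain ⟨n, hn⟩ := hev.exists
  obtain ⟨g, hg, hgf⟩ := (hf n).extend_finite_dimension
  have hge : ∀ x ∈ ball (0 : Plane) 1, dist (g x) (e x) ≤ 1 / 2 := fun x hx ↦ by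
    obtain ⟨y, hyU, hxy⟩ := Metric.mem_closure_iff.1 (hUd hx) s hs0
    obtain ⟨z, hz, hyz⟩ := mem_iUnion₂.1 (ht hyU)
    have hxz : dist x z ≤ 2 * s := by
      rw [mem_ball] at hyz
      linarith [dist_triangle x y z]
    have h1 : dist (g x) (g z) ≤ C * (2 * s) :=
      (hg.dist_le_mul x z).trans (by gcongr)
    have h2 := hn z hz
    rw [hgf (htU hz)] at h2
    have h3 : dist (e z) (e x) ≤ 2 * s := by rwa [e.dist_map, dist_comm]
    have h4 : C * (2 * s) + 2 * s = 1 / 4 := by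
      rw [hs]
      field_simp
      norm_num
    linarith [dist_triangle4 (g x) (g z) (e z) (e x)]
  refine ⟨n, hUv.trans_le (measure_mono fun p hp ↦ ?_)⟩
  obtain ⟨x, hx, hxp⟩ := mem_image_ball_of_dist_le (g := fun x ↦ e.symm (g x)) (R := 1)
    (p := e.symm p) (η := 1 / 2) (by norm_num)
    (e.symm.continuous.comp hg.continuous).continuousOn
    (fun z hz ↦ by
      rw [← e.dist_map]
      simpa using hge z hz)
    (by
      rw [mem_ball_zero_iff] at hp
      rw [e.symm.norm_map]
      linarith)
  rw [← e.symm.injective hxp, hgf.image_eq]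
  exact image_closure_subset_closure_image hg.continuous (mem_image_of_mem g (hUd hx))

/-- There are star-convex open sets of arbitrarily small area that are dense in the unit disc. -/
theorem exists_isOpen_starConvex_ball_subset_closure {ε : ℝ≥0∞} (hε : ε ≠ 0) :
    ∃ U : Set Plane, IsOpen U ∧ StarConvex ℝ 0 U ∧ 0 ∈ U ∧ Bornology.IsBounded U ∧
      ball 0 1 ⊆ closure U ∧ volume U < ε := by
  obtain ⟨D, hDc, hD⟩ := TopologicalSpace.exists_countable_dense Plane
  have hdense : ball (0 : Plane) 1 ⊆ closure (ball 0 1 ∩ D) :=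
    hD.open_subset_closure_inter isOpen_ball
  set S : Set Plane := ball 0 1 ∩ D
  have : Countable S := (hDc.mono inter_subset_right).to_subtype
  obtain ⟨η, hη, hηε⟩ := ENNReal.exists_pos_sum_of_countable hε S
  have hδ : ∀ p : S, ∃ δ > 0, δ ≤ 1 ∧
      volume (thickening δ (segment ℝ 0 (p : Plane))) ≤ η p := fun p ↦ by
    have hcpt : IsCompact (segment ℝ 0 (p : Plane)) := by
      rw [← convexHull_pair]
      exact (toFinite {0, (p : Plane)}).isCompact_convexHull (𝕜 := ℝ)
    have hlim := tendsto_measure_cthickening_of_isCompact (μ := volume) hcpt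
    rw [volume_segment_eq_zero] at hlim
    have hev := hlim.eventually_lt_const (show (0 : ℝ≥0∞) < η p from mod_cast hη p)
    obtain ⟨δ, h1, h2, h3⟩ := ((hev.filter_mono nhdsWithin_le_nhds).and
      (Ioc_mem_nhdsGT (zero_lt_one' ℝ))).exists
    exact ⟨δ, h2, h3, (measure_mono (thickening_subset_cthickening _ _)).trans h1.le⟩
  choose δ hδ0 hδ1 hδv using hδ
  have hseg : ∀ p : S, segment ℝ 0 (p : Plane) ⊆ thickening (δ p) (segment ℝ 0 (p : Plane)) :=
    fun p ↦ self_subset_thickening (hδ0 p) _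
  refine ⟨⋃ p : S, thickening (δ p) (segment ℝ 0 (p : Plane)),
    isOpen_iUnion fun p ↦ isOpen_thickening, starConvex_iUnion fun p ↦ ?_, ?_, ?_, ?_, ?_⟩
  · exact ((convex_segment _ _).thickening _).starConvex (hseg p (left_mem_segment _ _ _))
  · obtain ⟨p, hp⟩ := closure_nonempty_iff.1 ⟨0, hdense (mem_ball_self one_pos)⟩
    exact mem_iUnion.2 ⟨⟨p, hp⟩, hseg ⟨p, hp⟩ (left_mem_segment _ _ _)⟩
  · refine (isBounded_ball (x := (0 : Plane)) (r := 1)).thickening (δ := 1) |>.subset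
      (iUnion_subset fun p ↦ (thickening_mono (hδ1 p) _).trans (thickening_subset_of_subset _ ?_))
    exact (convex_ball _ _).segment_subset (mem_ball_self one_pos) p.2.1
  · exact hdense.trans (closure_mono fun p hp ↦
      mem_iUnion.2 ⟨⟨p, hp⟩, hseg ⟨p, hp⟩ (right_mem_segment _ _ _)⟩)
  · exact (measure_iUnion_le _).trans_lt ((ENNReal.tsum_le_tsum hδv).trans_lt hηε)

theorem stmt11 : ∃ (U : Set (EuclideanSpace ℝ (Fin 2))) (ε : ℝ≥0∞), 0 < ε ∧
    Bornology.IsBounded U ∧ IsOpen U ∧ SimplyConnectedSpace U ∧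
    ∀ f : EuclideanSpace ℝ (Fin 2) → EuclideanSpace ℝ (Fin 2),
      (∃ c : ℝ, c < 1 ∧ ∀ x ∈ U, ∀ y ∈ U, dist (f x) (f y) ≤ c * dist x y) →
      volume (f '' U) ≥ volume U - ε →
      0 < volume (frontier (f '' U)) ∧
      ¬ ∃ (n : ℕ) (p q : Fin n → EuclideanSpace ℝ (Fin 2)),
          frontier (f '' U) ⊆ ⋃ i, segment ℝ (p i) (q i) := by
  obtain ⟨U, hUo, hUs, h0, hUb, hUd, hUv⟩ := exists_isOpen_starConvex_ball_subset_closure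
    (measure_ball_pos volume (0 : Plane) (by norm_num : (0 : ℝ) < 1 / 2)).ne'
  have hcontr : ContractibleSpace U := hUs.contractibleSpace ⟨0, h0⟩
  have hUc : IsPreconnected U := (hUs.isPathConnected h0).isConnected.isPreconnected
  suffices h : ∃ ε : ℝ≥0∞, 0 < ε ∧ ∀ f : Plane → Plane, LipschitzOnWith 1 f U →
      volume U - ε ≤ volume (f '' U) → 0 < volume (frontier (f '' U)) by
    obtain ⟨ε, hε, h⟩ := h
    refine ⟨U, ε, hε, hUb, hUo, SimplyConnectedSpace.ofContractible U, fun f ⟨c, hc, hfc⟩ hfv ↦ ?_⟩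
    have hpos := h f (LipschitzOnWith.of_dist_le_mul fun x hx y hy ↦ (hfc x hx y hy).trans
      (by gcongr; exact hc.le)) hfv
    refine ⟨hpos, fun ⟨n, p, q, hpq⟩ ↦ hpos.ne' (measure_mono_null hpq ?_)⟩
    exact measure_iUnion_null fun i ↦ volume_segment_eq_zero _ _
  by_contra! hcon
  choose f hf hfv hfr using fun n : ℕ ↦ hcon ((n : ℝ≥0∞)⁻¹) (by simp)
  have himg : ∀ n, (fun x ↦ -f n 0 + f n x) '' U = (fun v ↦ -f n 0 + v) '' (f n '' U) := fun n ↦ by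
    rw [image_image]
  obtain ⟨n, hn⟩ := exists_volume_lt_volume_closure_image hUo hUc hUb h0 hUd hUv
    (f := fun n x ↦ -f n 0 + f n x) (ε := fun n ↦ (n : ℝ≥0∞)⁻¹)
    (fun n x hx y hy ↦ by simpa using hf n hx hy) (by simp)
    ENNReal.tendsto_inv_nat_nhds_zero (fun n ↦ by
      rw [himg, image_add_left, measure_preimage_add]
      exact tsub_le_iff_right.1 (hfv n))
  have hclosure : closure ((fun v ↦ -f n 0 + v) '' (f n '' U)) =
      (fun v ↦ -f n 0 + v) '' closure (f n '' U) :=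
    ((Homeomorph.addLeft (-f n 0)).image_closure _).symm
  rw [himg, hclosure, image_add_left, measure_preimage_add,
    measure_closure_of_null_frontier (le_zero_iff.1 (hfr n))] at hn
  exact hn.not_ge (volume_image_le_of_lipschitzOnWith_one (hf n))
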